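/- arXiv:2009.09489 — 2 statements merged into one kernel-verified Lean document; each statement's English description precedes it below -/
import Mathlib

section
/- Let u, w : ℝ × ℝ → ℝ be smooth functions satisfying the Bäcklund relations ∂_x(u − w) = sin(u + w) and ∂_y(u + w) = sin(u − w) at every point of ℝ². Then the function 2w also satisfies the sine-Gordon equation, i.e. ∂_x∂_y(2w) = sin(2w) at every point. -/
open Real

/-- Partial derivative in the first coordinate. -/
noncomputable def pdx (f : ℝ × ℝ → ℝ) (p : ℝ × ℝ) : ℝ := fderiv ℝ f p (1, 0)

/-- Partial derivative in the second coordinate. -/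
noncomputable def pdy (f : ℝ × ℝ → ℝ) (p : ℝ × ℝ) : ℝ := fderiv ℝ f p (0, 1)

theorem HasFDerivAt.pdx_eq {f : ℝ × ℝ → ℝ} {f' : ℝ × ℝ →L[ℝ] ℝ} {p : ℝ × ℝ}
    (h : HasFDerivAt f f' p) : pdx f p = f' (1, 0) := by
  rw [pdx, h.fderiv]

theorem HasFDerivAt.pdy_eq {f : ℝ × ℝ → ℝ} {f' : ℝ × ℝ →L[ℝ] ℝ} {p : ℝ × ℝ}
    (h : HasFDerivAt f f' p) : pdy f p = f' (0, 1) := by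
  rw [pdy, h.fderiv]

theorem pdx_sub {f g : ℝ × ℝ → ℝ} {p : ℝ × ℝ} (hf : DifferentiableAt ℝ f p)
    (hg : DifferentiableAt ℝ g p) : pdx (fun q => f q - g q) p = pdx f p - pdx g p :=
  (hf.hasFDerivAt.fun_sub hg.hasFDerivAt).pdx_eq

theorem pdy_sub {f g : ℝ × ℝ → ℝ} {p : ℝ × ℝ} (hf : DifferentiableAt ℝ f p)
    (hg : DifferentiableAt ℝ g p) : pdy (fun q => f q - g q) p = pdy f p - pdy g p :=
  (hf.hasFDerivAt.fun_sub hg.hasFDerivAt).pdy_eq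

theorem pdx_sin {f : ℝ × ℝ → ℝ} {p : ℝ × ℝ} (hf : DifferentiableAt ℝ f p) :
    pdx (fun q => Real.sin (f q)) p = Real.cos (f p) * pdx f p :=
  hf.hasFDerivAt.sin.pdx_eq

theorem pdy_sin {f : ℝ × ℝ → ℝ} {p : ℝ × ℝ} (hf : DifferentiableAt ℝ f p) :
    pdy (fun q => Real.sin (f q)) p = Real.cos (f p) * pdy f p :=
  hf.hasFDerivAt.sin.pdy_eq

theorem differentiable_fderiv_of_contDiff_two {f : ℝ × ℝ → ℝ} (hf : ContDiff ℝ 2 f) :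
    Differentiable ℝ (fderiv ℝ f) :=
  (hf.fderiv_right (m := 1) (by norm_num)).differentiable (by norm_num)

theorem differentiable_pdy {f : ℝ × ℝ → ℝ} (hf : ContDiff ℝ 2 f) :
    Differentiable ℝ (pdy f) :=
  (differentiable_fderiv_of_contDiff_two hf).clm_apply (differentiable_const _)

/-- Mixed partial derivatives of a `C²` function commute. -/
theorem pdx_pdy_comm {f : ℝ × ℝ → ℝ} (hf : ContDiff ℝ 2 f) (p : ℝ × ℝ) :
    pdx (pdy f) p = pdy (pdx f) p := by
  have hd (v : ℝ × ℝ) := ((differentiable_fderiv_of_contDiff_two hf) p).hasFDerivAt.clm_apply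
    (hasFDerivAt_const v p)
  have hsymm : IsSymmSndFDerivAt ℝ f p := hf.contDiffAt.isSymmSndFDerivAt (by simp)
  have hx : pdx (pdy f) p = fderiv ℝ (fderiv ℝ f) p (1, 0) (0, 1) :=
    (hd (0, 1)).pdx_eq.trans (by simp)
  have hy : pdy (pdx f) p = fderiv ℝ (fderiv ℝ f) p (0, 1) (1, 0) :=
    (hd (1, 0)).pdy_eq.trans (by simp)
  rw [hx, hy, hsymm.eq]

/-- If smooth `u, w` satisfy the Bäcklund relations, then `2w` also satisfies the
sine-Gordon equation. -/
theorem backlund_implies_sineGordon_w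
    (u w : ℝ × ℝ → ℝ) (hu : ContDiff ℝ (⊤ : ℕ∞) u) (hw : ContDiff ℝ (⊤ : ℕ∞) w)
    (hB1 : ∀ p : ℝ × ℝ, pdx (fun q => u q - w q) p = Real.sin (u p + w p))
    (hB2 : ∀ p : ℝ × ℝ, pdy (fun q => u q + w q) p = Real.sin (u p - w p)) :
    ∀ p : ℝ × ℝ, pdx (pdy (fun q => 2 * w q)) p = Real.sin (2 * w p) := by
  intro p
  have hle : (2 : WithTop ℕ∞) ≤ ((⊤ : ℕ∞) : WithTop ℕ∞) := WithTop.coe_le_coe.2 le_top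
  set a : ℝ × ℝ → ℝ := fun q => u q - w q with ha
  set b : ℝ × ℝ → ℝ := fun q => u q + w q with hb
  have ha2 : ContDiff ℝ 2 a := (hu.sub hw).of_le hle
  have hb2 : ContDiff ℝ 2 b := (hu.add hw).of_le hle
  have hda : Differentiable ℝ a := ha2.differentiable (by norm_num)
  have hdb : Differentiable ℝ b := hb2.differentiable (by norm_num)
  have hax : pdx a = fun q => Real.sin (b q) := funext hB1
  have hby : pdy b = fun q => Real.sin (a q) := funext hB2
  have hw2 : (fun q => 2 * w q) = fun q => b q - a q := by
    funext q
    simp only [ha, hb]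
    ring
  have hy : pdy (fun q => b q - a q) = fun q => pdy b q - pdy a q :=
    funext fun q => pdy_sub (hdb q) (hda q)
  rw [hw2, hy, pdx_sub (differentiable_pdy hb2 p) (differentiable_pdy ha2 p),
    pdx_pdy_comm ha2, hby, hax, pdx_sin (hda p), pdy_sin (hdb p), hax, hby,
    show 2 * w p = b p - a p from congrFun hw2 p, Real.sin_sub]
  ring
end

section
/- Let u, w : ℝ × ℝ → ℝ be smooth functions satisfying the Miura covering equations ∂_x w = u + (1/6) w² and ∂_t w = ∂_x² u + (1/3) w ∂_x u + (1/3) u² + (1/18) w² u at every point of ℝ², where u is a solution of the KdV equation ∂_t u = u ∂_x u + ∂_x³ u. Then w is a solution of the modified KdV equation ∂_t w = ∂_x³ w − (1/6) w² ∂_x w at every point. -/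
open Real

theorem pdx_add {f g : ℝ × ℝ → ℝ} {p : ℝ × ℝ} (hf : DifferentiableAt ℝ f p)
    (hg : DifferentiableAt ℝ g p) : pdx (fun q => f q + g q) p = pdx f p + pdx g p := by
  simp [pdx, fderiv_fun_add hf hg]

theorem pdx_mul {f g : ℝ × ℝ → ℝ} {p : ℝ × ℝ} (hf : DifferentiableAt ℝ f p)
    (hg : DifferentiableAt ℝ g p) :
    pdx (fun q => f q * g q) p = f p * pdx g p + g p * pdx f p := by
  simp [pdx, fderiv_fun_mul hf hg]

theorem pdx_const_mul {f : ℝ × ℝ → ℝ} {p : ℝ × ℝ} (hf : DifferentiableAt ℝ f p) (c : ℝ) :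
    pdx (fun q => c * f q) p = c * pdx f p := by
  simp [pdx, fderiv_const_mul hf]

theorem ContDiff.pdx {f : ℝ × ℝ → ℝ} (hf : ContDiff ℝ (⊤ : ℕ∞) f) :
    ContDiff ℝ (⊤ : ℕ∞) (pdx f) :=
  (hf.fderiv_right (m := (⊤ : ℕ∞)) le_rfl).clm_apply contDiff_const

/-- If `u` solves KdV and the pair `(u, w)` satisfies the Miura covering
equations, then `w` solves the modified KdV equation. -/
theorem miura_covering_gives_mkdv
    (u w : ℝ × ℝ → ℝ) (hu : ContDiff ℝ (⊤ : ℕ∞) u) (hw : ContDiff ℝ (⊤ : ℕ∞) w)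
    (hkdv : ∀ p : ℝ × ℝ, pdy u p = u p * pdx u p + pdx (pdx (pdx u)) p)
    (hc1 : ∀ p : ℝ × ℝ, pdx w p = u p + (1 / 6) * (w p) ^ 2)
    (hc2 : ∀ p : ℝ × ℝ,
      pdy w p = pdx (pdx u) p + (1 / 3) * w p * pdx u p
        + (1 / 3) * (u p) ^ 2 + (1 / 18) * (w p) ^ 2 * u p) :
    ∀ p : ℝ × ℝ,
      pdy w p = pdx (pdx (pdx w)) p - (1 / 6) * (w p) ^ 2 * pdx w p := by
  have hdu : Differentiable ℝ u := hu.differentiable (by simp)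
  have hdw : Differentiable ℝ w := hw.differentiable (by simp)
  have hdux : Differentiable ℝ (pdx u) := hu.pdx.differentiable (by simp)
  have hdwx : Differentiable ℝ (pdx w) := hw.pdx.differentiable (by simp)
  have hwx : pdx w = fun q => u q + (1 / 6) * (w q * w q) := by
    funext q
    rw [hc1 q, sq]
  have hwxx : pdx (pdx w) = fun q => pdx u q + (1 / 3) * (w q * pdx w q) := by
    funext q
    conv_lhs => rw [hwx]
    rw [pdx_add (hdu q) (((hdw q).fun_mul (hdw q)).const_mul _),
      pdx_const_mul ((hdw q).fun_mul (hdw q)), pdx_mul (hdw q) (hdw q)]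
    ring
  intro p
  have hwxxx : pdx (pdx (pdx w)) p =
      pdx (pdx u) p + (1 / 3) * (w p * pdx (pdx w) p + pdx w p * pdx w p) := by
    conv_lhs => rw [hwxx]
    rw [pdx_add (hdux p) (((hdw p).fun_mul (hdwx p)).const_mul _),
      pdx_const_mul ((hdw p).fun_mul (hdwx p)), pdx_mul (hdw p) (hdwx p)]
  rw [hwxxx, congrFun hwxx p, hc1 p, hc2 p]
  ring
end
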